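/- arXiv:1910.00209 — 3 statements merged into one kernel-verified Lean document; each statement's English description precedes it below -/
import Mathlib

section
/- Let G be a finite group, K := ℚ(G) the field of character values of G, and ℤ_K the ring of integers of K. Then every prime number dividing the order of the finite abelian group ℤ_K/ℤ[G] divides |G|. -/
open CategoryTheory Module Pointwise
open scoped MatrixGroups

/-- The set of all values `χ(g)` of irreducible complex characters `χ` of `G`. -/
noncomputable def charValues (G : Type) [Group G] : Set ℂ :=
  {z : ℂ | ∃ V : FDRep ℂ G, Simple V ∧ ∃ g : G, V.character g = z}

/-- `ℚ(G)`, the field of character values of `G`, as a subfield of `ℂ`. -/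
noncomputable def charField (G : Type) [Group G] : Subfield ℂ :=
  Subfield.closure (charValues G)

/-- `ℤ[G]`, the subring of `ℂ` generated by the character values of `G`. -/
noncomputable def charRing (G : Type) [Group G] : Subring ℂ :=
  Subring.closure (charValues G)

/-- The ring of integers of a subfield `K` of `ℂ`, i.e. the elements of `K` integral
over `ℤ`, as a subring of `ℂ`. -/
noncomputable def ringOfIntIn (K : Subfield ℂ) : Subring ℂ :=
  (integralClosure ℤ ℂ).toSubring ⊓ K.toSubring

/-- The additive quotient group `ℤ_{ℚ(G)}/ℤ[G]`. -/
noncomputable def charQuot (G : Type) [Group G] :=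
  ↥((ringOfIntIn (charField G)).toAddSubgroup) ⧸
    ((charRing G).toAddSubgroup.addSubgroupOf (ringOfIntIn (charField G)).toAddSubgroup)

noncomputable instance (G : Type) [Group G] : AddCommGroup (charQuot G) := by
  unfold charQuot; infer_instance

/-- The `m`-th cyclotomic field `ℚ(ζ_m)`, as the subfield of `ℂ` generated by the
`m`-th roots of unity. -/
noncomputable def cycField (m : ℕ) : Subfield ℂ :=
  Subfield.closure {z : ℂ | z ^ m = 1}

/-- The set of values `χ(g)` at a fixed `g` of irreducible complex characters `χ` of `G`. -/
noncomputable def charValuesAt {G : Type} [Group G] (g : G) : Set ℂ :=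
  {z : ℂ | ∃ V : FDRep ℂ G, Simple V ∧ V.character g = z}

/-- `ℚ(g)`, the subfield of `ℂ` generated by one column of the character table. -/
noncomputable def charFieldAt {G : Type} [Group G] (g : G) : Subfield ℂ :=
  Subfield.closure (charValuesAt g)

/-- `ℤ[g]`, the subring of `ℂ` generated by one column of the character table. -/
noncomputable def charRingAt {G : Type} [Group G] (g : G) : Subring ℂ :=
  Subring.closure (charValuesAt g)

section Characters

variable {G : Type} [Group G]

lemma simple_of_isIrreducible [Finite G] {V : Type} [AddCommGroup V] [Module ℂ V]
    [FiniteDimensional ℂ V] (ρ : Representation ℂ G V) [ρ.IsIrreducible] :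
    Simple (FDRep.of ρ) := by
  have := Fintype.ofFinite G
  have := invertibleOfNonzero (NeZero.ne (Nat.card G : ℂ))
  rw [FDRep.simple_iff_char_is_norm_one]
  have h := Representation.char_orthonormal ρ ρ
  rw [if_pos ⟨Representation.Equiv.refl ρ⟩, inv_mul_eq_one₀ (NeZero.ne _)] at h
  exact h.symm

lemma trace_eq_add_of_isCompl {K V : Type*} [Field K] [AddCommGroup V] [Module K V]
    [FiniteDimensional K V] {p q : Submodule K V} (hpq : IsCompl p q) (f : End K V)
    (hp : Set.MapsTo f p p) (hq : Set.MapsTo f q q) :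
    LinearMap.trace K V f =
      LinearMap.trace K p (f.restrict hp) + LinearMap.trace K q (f.restrict hq) := by
  have hint : DirectSum.IsInternal fun b : Bool ↦ cond b p q :=
    (DirectSum.isInternal_submodule_iff_isCompl _ Bool.true_eq_false.mp
      (by ext b; cases b <;> simp)).2 hpq
  have hm (b : Bool) : Set.MapsTo f (cond b p q : Submodule K V) (cond b p q : Submodule K V) := by
    cases b <;> assumption
  rw [LinearMap.trace_eq_sum_trace_restrict hint hm, Fintype.sum_bool]
  rfl

/-- The character values of every finite-dimensional representation lie in `ℤ[G]`. -/
lemma character_mem_charRing [Finite G] {V : Type} [AddCommGroup V] [Module ℂ V]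
    [FiniteDimensional ℂ V] (ρ : Representation ℂ G V) (g : G) :
    ρ.character g ∈ charRing G := by
  induction hn : finrank ℂ V using Nat.strong_induction_on generalizing V with
  | _ n ih =>
  subst hn
  by_cases hirr : ρ.IsIrreducible
  · exact Subring.subset_closure ⟨FDRep.of ρ, simple_of_isIrreducible ρ, g, rfl⟩
  by_cases htriv : Subsingleton V
  · have : ρ g = 0 := Subsingleton.elim _ _
    simp [Representation.character, this]
  rw [not_subsingleton_iff_nontrivial] at htriv
  obtain ⟨S, hS0, hS1⟩ : ∃ S : Subrepresentation ρ, S ≠ ⊥ ∧ S ≠ ⊤ := by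
    by_contra! h
    have : Nontrivial (Subrepresentation ρ) :=
      ⟨⊥, ⊤, fun h ↦ bot_ne_top (α := Submodule ℂ V) (congrArg Subrepresentation.toSubmodule h)⟩
    exact hirr ⟨fun S ↦ or_iff_not_imp_left.2 (h S)⟩
  obtain ⟨T, hST⟩ := exists_isCompl S
  have hc : IsCompl S.toSubmodule T.toSubmodule := by
    refine IsCompl.of_eq ?_ ?_
    · exact congrArg Subrepresentation.toSubmodule hST.inf_eq_bot
    · exact congrArg Subrepresentation.toSubmodule hST.sup_eq_top
  have hSlt : finrank ℂ S.toSubmodule < finrank ℂ V := Submodule.finrank_lt fun h ↦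
    hS1 (Subrepresentation.toSubmodule_injective h)
  have hTlt : finrank ℂ T.toSubmodule < finrank ℂ V := Submodule.finrank_lt fun h ↦ by
    rw [h] at hc
    exact hS0 (Subrepresentation.toSubmodule_injective (eq_bot_of_isCompl_top hc))
  have := trace_eq_add_of_isCompl hc (ρ g) (S.apply_mem_toSubmodule g) (T.apply_mem_toSubmodule g)
  rw [Representation.character, this]
  exact add_mem (ih _ hSlt S.toRepresentation rfl) (ih _ hTlt T.toRepresentation rfl)

lemma trace_mul_mem_charRing [Finite G] {V : Type} [AddCommGroup V] [Module ℂ V]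
    [FiniteDimensional ℂ V] (ρ : Representation ℂ G V) {P : End ℂ V} (hP : IsIdempotentElem P)
    (hcomm : ∀ g, Commute (ρ g) P) (g : G) :
    LinearMap.trace ℂ V (ρ g * P) ∈ charRing G := by
  have hinv (g : G) ⦃v : V⦄ (hv : v ∈ LinearMap.range P) : ρ g v ∈ LinearMap.range P := by
    obtain ⟨w, rfl⟩ := hv
    exact ⟨ρ g w, LinearMap.congr_fun (hcomm g).eq.symm w⟩
  let S : Subrepresentation ρ := ⟨LinearMap.range P, hinv⟩
  have hmem (v : V) : (ρ g * P) v ∈ LinearMap.range P := hinv g ⟨v, rfl⟩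
  rw [← LinearMap.trace_restrict_eq_of_forall_mem _ _ hmem fun v _ ↦ hmem v]
  convert character_mem_charRing S.toRepresentation g using 1
  rw [Representation.character]
  congr 1
  ext ⟨v, hv⟩
  have : P v = v := (LinearMap.IsIdempotentElem.isProj_range P hP).map_id v hv
  change ρ g (P v) = ρ g v
  rw [this]

end Characters

section SpectralProjection

variable {A : Type*} [Ring A] [Algebra ℂ A]

/-- The projection onto the `ζ ^ i`-eigenspace of an element `T` with `T ^ n = 1`, where `ζ` is a
primitive `n`-th root of unity. -/
noncomputable def spectralProj (ζ : ℂ) (n : ℕ) (T : A) (i : ℕ) : A :=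
  (n : ℂ)⁻¹ • ∑ j ∈ Finset.range n, ((ζ ^ i)⁻¹ ^ j) • T ^ j

variable {ζ : ℂ} {n : ℕ} {T : A}

lemma commute_spectralProj {B : A} (h : Commute B T) (i : ℕ) :
    Commute B (spectralProj ζ n T i) :=
  (Commute.sum_right _ _ _ fun j _ ↦ (h.pow_right j).smul_right _).smul_right _

lemma mul_spectralProj (hζ : IsPrimitiveRoot ζ n) (hn : n ≠ 0) (hT : T ^ n = 1) (i : ℕ) :
    T * spectralProj ζ n T i = ζ ^ i • spectralProj ζ n T i := by
  have h0 : ζ ^ i ≠ 0 := pow_ne_zero _ (hζ.ne_zero hn)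
  rw [spectralProj, mul_smul_comm, smul_comm (ζ ^ i)]
  congr 1
  rw [Finset.mul_sum, Finset.smul_sum]
  have h1 := Finset.sum_range_succ' (fun j ↦ ζ ^ i • ((ζ ^ i)⁻¹ ^ j) • T ^ j) n
  rw [Finset.sum_range_succ] at h1
  have h2 : (ζ ^ i)⁻¹ ^ n = 1 := by
    rw [inv_pow, ← pow_mul, mul_comm, pow_mul, hζ.pow_eq_one, one_pow, inv_one]
  simp only [h2, hT, pow_zero, add_left_inj] at h1
  rw [h1]
  refine Finset.sum_congr rfl fun j _ ↦ ?_
  rw [mul_smul_comm, ← pow_succ', smul_smul, pow_succ' (ζ ^ i)⁻¹, mul_inv_cancel_left₀ h0]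

lemma pow_mul_spectralProj (hζ : IsPrimitiveRoot ζ n) (hn : n ≠ 0) (hT : T ^ n = 1) (i j : ℕ) :
    T ^ j * spectralProj ζ n T i = (ζ ^ i) ^ j • spectralProj ζ n T i := by
  induction j with
  | zero => simp
  | succ j ih =>
    rw [pow_succ, mul_assoc, mul_spectralProj hζ hn hT, mul_smul_comm, ih, smul_smul, pow_succ']

lemma isIdempotentElem_spectralProj (hζ : IsPrimitiveRoot ζ n) (hn : n ≠ 0) (hT : T ^ n = 1)
    (i : ℕ) : IsIdempotentElem (spectralProj ζ n T i) := by
  have h0 : ζ ^ i ≠ 0 := pow_ne_zero _ (hζ.ne_zero hn)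
  have hn' : (n : ℂ) ≠ 0 := mod_cast hn
  rw [IsIdempotentElem]
  nth_rw 1 [spectralProj]
  rw [smul_mul_assoc, Finset.sum_mul]
  simp only [smul_mul_assoc, pow_mul_spectralProj hζ hn hT, smul_smul, ← mul_pow,
    inv_mul_cancel₀ h0, one_pow, one_smul, Finset.sum_const, Finset.card_range]
  rw [← Nat.cast_smul_eq_nsmul ℂ, smul_smul, inv_mul_cancel₀ hn', one_smul]

lemma sum_spectralProj (hζ : IsPrimitiveRoot ζ n) (hn : n ≠ 0) (hT : T ^ n = 1) (k : ℕ) :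
    ∑ i ∈ Finset.range n, (ζ ^ k) ^ i • spectralProj ζ n T i = T ^ k := by
  have hn' : (n : ℂ) ≠ 0 := mod_cast hn
  have hk : k % n < n := Nat.mod_lt _ (Nat.pos_of_ne_zero hn)
  have hz : ζ ^ k = ζ ^ (k % n) := pow_eq_pow_mod k hζ.pow_eq_one
  rw [pow_eq_pow_mod k hT, hz]
  generalize k % n = k at hk
  have horth (j : ℕ) (hj : j < n) :
      ∑ i ∈ Finset.range n, (ζ ^ k * (ζ ^ j)⁻¹) ^ i = if j = k then (n : ℂ) else 0 := by
    split_ifs with h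
    · simp [h, mul_inv_cancel₀ (pow_ne_zero k (hζ.ne_zero hn))]
    · have hne : ζ ^ k * (ζ ^ j)⁻¹ ≠ 1 := by
        rw [Ne, mul_inv_eq_one₀ (pow_ne_zero _ (hζ.ne_zero hn))]
        exact fun h' ↦ h (hζ.pow_inj hk hj h').symm
      rw [geom_sum_eq hne, mul_pow, inv_pow, ← pow_mul, ← pow_mul, mul_comm k, mul_comm j,
        pow_mul, pow_mul, hζ.pow_eq_one]
      simp
  simp only [spectralProj, Finset.smul_sum, smul_smul]
  rw [Finset.sum_comm]
  have (j : ℕ) (hj : j ∈ Finset.range n) : ∑ i ∈ Finset.range n,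
      ((ζ ^ k) ^ i * ((n : ℂ)⁻¹ * (ζ ^ i)⁻¹ ^ j)) • T ^ j = if j = k then T ^ j else 0 := by
    have h (i : ℕ) : (ζ ^ k) ^ i * ((n : ℂ)⁻¹ * (ζ ^ i)⁻¹ ^ j) =
        (n : ℂ)⁻¹ * (ζ ^ k * (ζ ^ j)⁻¹) ^ i := by
      rw [mul_pow, inv_pow, inv_pow, ← pow_mul ζ i, ← pow_mul ζ j, mul_comm i j]
      ring
    rw [← Finset.sum_smul]
    simp only [h]
    rw [← Finset.mul_sum, horth j (Finset.mem_range.1 hj)]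
    split_ifs
    · rw [inv_mul_cancel₀ hn', one_smul]
    · simp
  rw [Finset.sum_congr rfl this, Finset.sum_ite_eq' , if_pos (Finset.mem_range.2 hk)]

end SpectralProjection

section Translations

variable {G : Type} [Group G]

lemma trace_funLeft {X : Type*} [Finite X] (π : Equiv.Perm X) :
    LinearMap.trace ℂ (X → ℂ) (LinearMap.funLeft ℂ ℂ π) = Nat.card {x // π x = x} := by
  classical
  have := Fintype.ofFinite X
  have h : LinearMap.funLeft ℂ ℂ π = Matrix.toLin' (π.permMatrix ℂ) := by
    refine LinearMap.ext fun f ↦ ?_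
    rw [Matrix.toLin'_apply, Matrix.permMatrix_mulVec]
    rfl
  rw [h, Matrix.trace_toLin'_eq, Matrix.trace_permutation]
  rfl

/-- The action of `G` on functions `G → ℂ` by left translation. -/
noncomputable def leftTranslation (G : Type) [Group G] : Representation ℂ G (G → ℂ) where
  toFun g := LinearMap.funLeft ℂ ℂ (g⁻¹ * ·)
  map_one' := by ext; simp [LinearMap.funLeft_apply]
  map_mul' g h := by
    ext f x
    simp [LinearMap.funLeft_apply, mul_assoc]

/-- Right translation by `h` on functions `G → ℂ`. -/
noncomputable def rightTranslation (h : G) : End ℂ (G → ℂ) :=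
  LinearMap.funLeft ℂ ℂ (· * h)

lemma rightTranslation_pow (h : G) (k : ℕ) : rightTranslation h ^ k = rightTranslation (h ^ k) := by
  induction k with
  | zero =>
    ext f x
    simp [rightTranslation, LinearMap.funLeft_apply]
  | succ k ih =>
    rw [pow_succ, ih]
    refine LinearMap.ext fun f ↦ funext fun x ↦ ?_
    change f (x * h ^ k * h) = f (x * h ^ (k + 1))
    rw [pow_succ, mul_assoc]

lemma rightTranslation_one : rightTranslation (1 : G) = 1 := by
  simpa using (rightTranslation_pow (1 : G) 0).symm

lemma commute_leftTranslation_rightTranslation (g h : G) :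
    Commute (leftTranslation G g) (rightTranslation h) := by
  refine LinearMap.ext fun f ↦ funext fun x ↦ ?_
  change f (g⁻¹ * x * h) = f (g⁻¹ * (x * h))
  rw [mul_assoc]

lemma trace_leftTranslation_mul_rightTranslation [Finite G] (g h : G) :
    LinearMap.trace ℂ (G → ℂ) (leftTranslation G g * rightTranslation h) =
      Nat.card {x : G // x * h = g * x} := by
  have := trace_funLeft ((Equiv.mulLeft g⁻¹).trans (Equiv.mulRight h))
  refine (Eq.trans ?_ this).trans (congrArg Nat.cast (Nat.card_congr ?_))
  · rfl
  · exact Equiv.subtypeEquivRight fun x ↦ by simp [mul_assoc, inv_mul_eq_iff_eq_mul]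

/-- The value at `g` of the character of `G` induced from the `i`-th linear character of the cyclic
group generated by `g`. -/
noncomputable def inducedValue (ζ : ℂ) (n : ℕ) (g : G) (i : ℕ) : ℂ :=
  LinearMap.trace ℂ (G → ℂ) (leftTranslation G g * spectralProj ζ n (rightTranslation g) i)

variable {ζ : ℂ} {n : ℕ}

lemma inducedValue_mem_charRing [Finite G] (hζ : IsPrimitiveRoot ζ n) (hn : n ≠ 0) {g : G}
    (hg : g ^ n = 1) (i : ℕ) : inducedValue ζ n g i ∈ charRing G := by
  refine trace_mul_mem_charRing _ (isIdempotentElem_spectralProj hζ hn ?_ i)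
    (fun h ↦ commute_spectralProj (commute_leftTranslation_rightTranslation h g) i) g
  rw [rightTranslation_pow, hg, rightTranslation_one]

lemma sum_inducedValue [Finite G] (hζ : IsPrimitiveRoot ζ n) (hn : n ≠ 0) {g : G}
    (hg : g ^ n = 1) (k : ℕ) :
    ∑ i ∈ Finset.range n, (ζ ^ k) ^ i * inducedValue ζ n g i =
      Nat.card {x : G // x * g ^ k = g * x} := by
  have hT : rightTranslation g ^ n = 1 := by rw [rightTranslation_pow, hg, rightTranslation_one]
  rw [← trace_leftTranslation_mul_rightTranslation, ← rightTranslation_pow,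
    ← sum_spectralProj hζ hn hT k, Finset.mul_sum, map_sum]
  simp only [mul_smul_comm, map_smul, smul_eq_mul, inducedValue]

/-- Character values at powers of `g` are obtained from those at `g` by raising the roots of unity
to that power. -/
lemma exists_character_pow_eq_sum {V : Type} [AddCommGroup V] [Module ℂ V]
    [FiniteDimensional ℂ V] (ρ : Representation ℂ G V) (hζ : IsPrimitiveRoot ζ n) (hn : n ≠ 0)
    {g : G} (hg : g ^ n = 1) :
    ∃ m : ℕ → ℕ, ∀ k, ρ.character (g ^ k) = ∑ i ∈ Finset.range n, (ζ ^ k) ^ i * m i := by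
  have hT : ρ g ^ n = 1 := by rw [← map_pow, hg, map_one]
  refine ⟨fun i ↦ finrank ℂ (LinearMap.range (spectralProj ζ n (ρ g) i)), fun k ↦ ?_⟩
  rw [Representation.character, map_pow, ← sum_spectralProj hζ hn hT k, map_sum]
  refine Finset.sum_congr rfl fun i _ ↦ ?_
  rw [map_smul, smul_eq_mul, LinearMap.IsProj.trace
    (LinearMap.IsIdempotentElem.isProj_range _ (isIdempotentElem_spectralProj hζ hn hT i))]

end Translations

section PowerConjugation

variable (G : Type) [Group G]

variable {G} in
lemma pow_val_mul (u v : ZMod (Monoid.exponent G)) (g : G) :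
    g ^ (u * v).val = (g ^ u.val) ^ v.val := by
  rw [← pow_mul, ZMod.val_mul, ← Monoid.pow_eq_mod_exponent]

variable {G} in
lemma pow_val_one (g : G) : g ^ (1 : ZMod (Monoid.exponent G)).val = g := by
  rw [← Nat.cast_one, ZMod.val_natCast, ← Monoid.pow_eq_mod_exponent, pow_one]

/-- The units `u` modulo the exponent of `G` such that every `g : G` is conjugate to `g ^ u`. -/
def powerConjSubgroup : Subgroup (ZMod (Monoid.exponent G))ˣ where
  carrier := {u | ∀ g : G, IsConj g (g ^ (u : ZMod (Monoid.exponent G)).val)}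
  one_mem' g := by rw [Units.val_one, pow_val_one]
  mul_mem' {u v} hu hv g := by
    rw [Units.val_mul, pow_val_mul]
    exact (hu g).trans (hv _)
  inv_mem' {u} hu g := by
    have := hu (g ^ (↑u⁻¹ : ZMod (Monoid.exponent G)).val)
    rw [← pow_val_mul, Units.inv_mul, pow_val_one] at this
    exact this.symm

/-- Every prime dividing the order of `powerConjSubgroup G` divides the order of `G`. -/
lemma prime_dvd_card_of_dvd_card_powerConjSubgroup [Finite G] {p : ℕ} (hp : p.Prime)
    (hdvd : p ∣ Nat.card (powerConjSubgroup G)) : p ∣ Nat.card G := by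
  have : NeZero (Monoid.exponent G) := ⟨Monoid.exponent_ne_zero_of_finite⟩
  have := Fact.mk hp
  by_contra hG
  obtain ⟨⟨u, hu⟩, hup⟩ := exists_prime_orderOf_dvd_card' p hdvd
  rw [Subgroup.orderOf_mk] at hup
  have hpow (g : G) : g ^ (u : ZMod (Monoid.exponent G)).val = g := by
    obtain ⟨x, hx⟩ := isConj_iff.1 (hu g)
    have hiter (k : ℕ) :
        x ^ k * g * (x ^ k)⁻¹ = g ^ (↑(u ^ k) : ZMod (Monoid.exponent G)).val := by
      induction k with
      | zero => simp [pow_val_one]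
      | succ k ih =>
        rw [pow_succ, pow_succ', Units.val_mul, pow_val_mul, ← hx, conj_pow, ← ih]
        group
    have hxp : Commute (x ^ p) g := by
      have := hiter p
      rw [← hup, pow_orderOf_eq_one, Units.val_one, pow_val_one, hup] at this
      exact mul_inv_eq_iff_eq_mul.1 this
    have hcop : (orderOf x).Coprime p :=
      ((hp.coprime_iff_not_dvd.2 hG).coprime_dvd_right (orderOf_dvd_natCard x)).symm
    obtain ⟨m, hm⟩ := exists_pow_eq_self_of_coprime hcop.symm
    rw [← hx, mul_inv_eq_iff_eq_mul]
    have := hxp.pow_left m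
    rwa [hm] at this
  have h1 : u = 1 := by
    have hcast : ((u : ZMod (Monoid.exponent G)).val : ℤ) ≡ 1 [ZMOD Monoid.exponent G] := by
      rw [Int.modEq_comm, Int.modEq_iff_dvd, Group.exponent_dvd_iff_forall_zpow_eq_one]
      intro g
      rw [zpow_sub, zpow_natCast, hpow, zpow_one, mul_inv_cancel]
    rw [← ZMod.intCast_eq_intCast_iff] at hcast
    ext
    simpa using hcast
  rw [h1, orderOf_one] at hup
  exact hp.one_lt.ne hup

variable {G}

lemma card_conjugators_eq {g h : G} (hgh : IsConj g h) :
    Nat.card {x : G // x * h = g * x} = Nat.card (Subgroup.centralizer {g}) := by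
  obtain ⟨y, rfl⟩ := isConj_iff.1 hgh
  refine Nat.card_congr ((Equiv.mulRight y).subtypeEquiv fun x ↦ ?_)
  rw [Subgroup.mem_centralizer_singleton_iff, Equiv.coe_mulRight]
  constructor
  · intro hx
    calc x * y * g = x * (y * g * y⁻¹) * y := by group
      _ = g * (x * y) := by rw [hx, mul_assoc]
  · intro hx
    calc x * (y * g * y⁻¹) = x * y * g * y⁻¹ := by group
      _ = g * x := by rw [hx]; group

lemma card_conjugators_eq_zero {g h : G} (hgh : ¬ IsConj g h) :
    Nat.card {x : G // x * h = g * x} = 0 := by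
  have : IsEmpty {x : G // x * h = g * x} :=
    ⟨fun ⟨x, hx⟩ ↦ hgh (IsConj.symm (isConj_iff.2 ⟨x, by rw [hx]; group⟩))⟩
  exact Nat.card_of_isEmpty

end PowerConjugation

section Galois

variable {G : Type} [Group G] {L : Type} [Field L] [NumberField L] {ζ : L}

lemma charField_le_map_eqLocusField [NeZero (Monoid.exponent G)] (ι : L →+* ℂ)
    (hζ : IsPrimitiveRoot ζ (Monoid.exponent G))
    {σ : Gal(L/ℚ)} (hσ : hζ.autToPow ℚ σ ∈ powerConjSubgroup G) :
    charField G ≤ (ι.eqLocusField (ι.comp (σ : L →+* L))).map ι := by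
  have hn : Monoid.exponent G ≠ 0 := NeZero.ne _
  refine Subfield.closure_le.2 ?_
  rintro _ ⟨V, -, g, rfl⟩
  obtain ⟨m, hm⟩ := exists_character_pow_eq_sum V.ρ (hζ.map_of_injective ι.injective) hn
    (Monoid.pow_exponent_eq_one g)
  have hg : V.character g = Representation.character V.ρ (g ^ 1) := by rw [pow_one]; rfl
  refine ⟨∑ i ∈ Finset.range (Monoid.exponent G), ζ ^ i * m i, ?_, ?_⟩
  · change ι _ = ι (σ _)
    obtain ⟨x, hx⟩ := isConj_iff.1 (hσ g)
    have h1 := hm (hζ.autToPow ℚ σ : ZMod (Monoid.exponent G)).val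
    rw [← hx, Representation.char_conj, ← pow_one g, hm 1, ← map_pow ι ζ,
      ← map_pow ι ζ, hζ.autToPow_spec ℚ] at h1
    simpa using h1
  · rw [hg, hm 1]
    simp

lemma mem_range_of_mem_charField [NeZero (Monoid.exponent G)] (ι : L →+* ℂ)
    (hζ : IsPrimitiveRoot ζ (Monoid.exponent G))
    {z : ℂ} (hz : z ∈ charField G) : ∃ x, ι x = z := by
  have h1 : hζ.autToPow ℚ 1 ∈ powerConjSubgroup G := by
    rw [map_one]
    exact one_mem _
  obtain ⟨x, -, hx⟩ := charField_le_map_eqLocusField ι hζ h1 hz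
  exact ⟨x, hx⟩

lemma map_apply_eq_of_mem_charField [NeZero (Monoid.exponent G)] (ι : L →+* ℂ)
    (hζ : IsPrimitiveRoot ζ (Monoid.exponent G))
    {σ : Gal(L/ℚ)} (hσ : hζ.autToPow ℚ σ ∈ powerConjSubgroup G) {x : L}
    (hx : ι x ∈ charField G) : ι (σ x) = ι x := by
  obtain ⟨y, hy, hyx⟩ := charField_le_map_eqLocusField ι hζ hσ hx
  rw [ι.injective hyx] at hy
  exact hy.symm

lemma sum_map_apply_mem_charRing [IsGalois ℚ L] (ι : L →+* ℂ) {x : L} (hx : IsIntegral ℤ x) :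
    ∑ σ : Gal(L/ℚ), ι (σ x) ∈ charRing G := by
  have h := trace_eq_sum_automorphisms (K := ℚ) x
  obtain ⟨t, ht⟩ := IsIntegrallyClosed.isIntegral_iff.1 (Algebra.isIntegral_trace (L := ℚ) hx)
  rw [← map_sum, ← h, ← ht]
  simp

/-- A multiple of each integer of `ℚ(G)` lies in `ℤ[G]`. -/
lemma card_mul_prod_mul_mem_charRing [Finite G] [NeZero (Monoid.exponent G)] [IsGalois ℚ L]
    (ι : L →+* ℂ) (hζ : IsPrimitiveRoot ζ (Monoid.exponent G)) {x : L} (hx : IsIntegral ℤ x)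
    (hxK : ι x ∈ charField G) :
    ((Nat.card ((powerConjSubgroup G).comap (hζ.autToPow ℚ)) *
      ∏ᶠ g : G, Nat.card (Subgroup.centralizer {g}) : ℕ) : ℂ) * ι x ∈ charRing G := by
  classical
  have := Fintype.ofFinite G
  have hn : Monoid.exponent G ≠ 0 := NeZero.ne _
  have hζC := hζ.map_of_injective ι.injective
  set n := Monoid.exponent G
  let ψ : G → ℕ → ℂ := fun g i ↦ inducedValue (ι ζ) n g i
  let a : Gal(L/ℚ) → ℕ := fun σ ↦ (hζ.autToPow ℚ σ : ZMod n).val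
  have hsum (σ : Gal(L/ℚ)) (g : G) : ∑ i ∈ Finset.range n, ι (σ ζ) ^ i * ψ g i =
      Nat.card {x : G // x * g ^ a σ = g * x} := by
    rw [← sum_inducedValue hζC hn (Monoid.pow_exponent_eq_one g) (a σ), ← map_pow ι,
      hζ.autToPow_spec ℚ]
  have hterm (σ : Gal(L/ℚ)) : ι (σ x) * ∏ g, ∑ i ∈ Finset.range n, ι (σ ζ) ^ i * ψ g i =
      if σ ∈ (powerConjSubgroup G).comap (hζ.autToPow ℚ) then
        ((∏ᶠ g : G, Nat.card (Subgroup.centralizer {g}) : ℕ) : ℂ) * ι x else 0 := by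
    simp only [hsum]
    split_ifs with h
    · rw [map_apply_eq_of_mem_charField ι hζ h hxK, mul_comm, finprod_eq_prod_of_fintype,
        Nat.cast_prod]
      simp only [card_conjugators_eq (h _), a]
    · have : ∃ g : G, ¬ IsConj g (g ^ a σ) := by
        by_contra! hc
        exact h hc
      obtain ⟨g, hg⟩ := this
      have h0 := card_conjugators_eq_zero hg
      rw [Finset.prod_eq_zero (Finset.mem_univ g) (by rw [h0, Nat.cast_zero]), mul_zero]
  have hleft : ((Nat.card ((powerConjSubgroup G).comap (hζ.autToPow ℚ)) *
      ∏ᶠ g : G, Nat.card (Subgroup.centralizer {g}) : ℕ) : ℂ) * ι x =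
      ∑ σ : Gal(L/ℚ), ι (σ x) * ∏ g, ∑ i ∈ Finset.range n, ι (σ ζ) ^ i * ψ g i := by
    simp only [hterm]
    rw [← Finset.sum_filter, Finset.sum_const, nsmul_eq_mul, Nat.cast_mul, mul_assoc,
      Nat.card_eq_fintype_card, Fintype.card_subtype]
  rw [hleft]
  simp only [Finset.prod_univ_sum, Finset.mul_sum]
  rw [Finset.sum_comm]
  refine sum_mem fun f _ ↦ ?_
  have (σ : Gal(L/ℚ)) : ι (σ x) * ∏ g, ι (σ ζ) ^ f g * ψ g (f g) =
      (∏ g, ψ g (f g)) * ι (σ (x * ζ ^ ∑ g, f g)) := by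
    rw [Finset.prod_mul_distrib, Finset.prod_pow_eq_pow_sum]
    simp only [map_mul, map_pow]
    ring
  simp only [this]
  rw [← Finset.mul_sum]
  refine mul_mem (prod_mem fun g _ ↦ ?_) (sum_map_apply_mem_charRing ι ?_)
  · exact inducedValue_mem_charRing hζC hn (Monoid.pow_exponent_eq_one g) _
  · exact hx.mul ((hζ.isIntegral (Nat.pos_of_ne_zero hn)).pow _)

end Galois

/-- Every prime dividing the order of `ℤ_{ℚ(G)}/ℤ[G]` divides `|G|`. -/
theorem prime_dvd_card_charQuot_dvd_card (G : Type) [Group G] [Finite G]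
    (p : ℕ) (hp : p.Prime) (hdvd : p ∣ Nat.card (charQuot G)) :
    p ∣ Nat.card G := by
  have : NeZero (Monoid.exponent G) := ⟨Monoid.exponent_ne_zero_of_finite⟩
  have := Fact.mk hp
  let L := CyclotomicField (Monoid.exponent G) ℚ
  have : IsCyclotomicExtension {Monoid.exponent G} ℚ L :=
    CyclotomicField.isCyclotomicExtension _ ℚ
  have : NumberField L := IsCyclotomicExtension.numberField {Monoid.exponent G} ℚ L
  have : IsGalois ℚ L := IsCyclotomicExtension.isGalois {Monoid.exponent G} ℚ L
  have hζ := IsCyclotomicExtension.zeta_spec (Monoid.exponent G) ℚ L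
  let ι : L →+* ℂ := (IsAlgClosed.lift (R := ℚ) (S := L) (M := ℂ)).toRingHom
  have hlift {z : ℂ} (hz : z ∈ ringOfIntIn (charField G)) : ∃ x : L, IsIntegral ℤ x ∧ ι x = z := by
    obtain ⟨x, rfl⟩ := mem_range_of_mem_charField ι hζ hz.2
    exact ⟨x, (isIntegral_algHom_iff ι.toIntAlgHom ι.injective).1 hz.1, rfl⟩
  set M := Nat.card ((powerConjSubgroup G).comap (hζ.autToPow ℚ)) *
    ∏ᶠ g : G, Nat.card (Subgroup.centralizer {g}) with hM
  have hM0 : M ≠ 0 := by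
    have := Fintype.ofFinite G
    rw [hM, finprod_eq_prod_of_fintype]
    exact mul_ne_zero Nat.card_pos.ne' (Finset.prod_ne_zero_iff.2 fun g _ ↦ Nat.card_pos.ne')
  let A := (ringOfIntIn (charField G)).toAddSubgroup
  let B := (charRing G).toAddSubgroup.addSubgroupOf A
  have hkill (q : A ⧸ B) : M • q = 0 := by
    obtain ⟨⟨z, hz⟩, rfl⟩ := QuotientAddGroup.mk_surjective q
    obtain ⟨x, hx, rfl⟩ := hlift hz
    rw [← QuotientAddGroup.mk_nsmul, QuotientAddGroup.eq_zero_iff, AddSubgroup.mem_addSubgroupOf]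
    have := card_mul_prod_mul_mem_charRing ι hζ hx hz.2
    rw [← nsmul_eq_mul] at this
    exact this
  have hfin : Finite (A ⧸ B) := by
    have hle : AddSubgroup.toIntSubmodule A ≤
        LinearMap.range (ι.toAddMonoidHom.toIntLinearMap ∘ₗ
          (algebraMap (NumberField.RingOfIntegers L) L).toAddMonoidHom.toIntLinearMap) := by
      intro z hz
      obtain ⟨x, hx, rfl⟩ := hlift hz
      exact ⟨⟨x, hx⟩, rfl⟩
    have hnoeth := isNoetherian_of_le hle
    have : Module.Finite ℤ A := inferInstanceAs (Module.Finite ℤ (AddSubgroup.toIntSubmodule A))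
    have : AddGroup.FG A := Module.Finite.iff_addGroup_fg.1 this
    refine AddCommGroup.finite_of_fg_isAddTorsion _ fun q ↦ ?_
    exact isOfFinAddOrder_iff_nsmul_eq_zero.2 ⟨M, Nat.pos_of_ne_zero hM0, hkill q⟩
  obtain ⟨q, hq⟩ := exists_prime_addOrderOf_dvd_card' (G := A ⧸ B) p hdvd
  have hpM : p ∣ M := hq ▸ addOrderOf_dvd_of_nsmul_eq_zero (hkill q)
  rcases hp.dvd_mul.1 hpM with h | h
  · refine prime_dvd_card_of_dvd_card_powerConjSubgroup G hp (h.trans ?_)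
    exact Subgroup.card_comap_dvd_of_injective _ _
      (hζ.autToPow_injective ℚ)
  · have := Fintype.ofFinite G
    rw [finprod_eq_prod_of_fintype, hp.prime.dvd_finsetProd_iff] at h
    obtain ⟨g, -, hg⟩ := h
    exact hg.trans (Subgroup.card_subgroup_dvd_card _)
end

section
/- Let n be a positive integer and let K be any subfield of the n-th cyclotomic field ℚ_n = ℚ(ζ_n). Then the absolute discriminant d_K of K divides n^{φ(n)}, where φ denotes Euler's totient function. -/
open CategoryTheory Module Pointwise
open scoped MatrixGroups

open IntermediateField in
theorem IsPrimitiveRoot.cycField_le_adjoin {n : ℕ} [NeZero n] {ζ : ℂ}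
    (hζ : IsPrimitiveRoot ζ n) : cycField n ≤ ℚ⟮ζ⟯.toSubfield := by
  refine Subfield.closure_le.mpr fun z hz => ?_
  obtain ⟨k, -, rfl⟩ := hζ.eq_pow_of_pow_eq_one hz
  exact pow_mem (mem_adjoin_simple_self ℚ ζ) k

theorem IsCyclotomicExtension.Rat.discr_dvd_pow_totient (n : ℕ) [NeZero n] (L : Type*) [Field L]
    [NumberField L] [IsCyclotomicExtension {n} ℚ L] :
    NumberField.discr L ∣ (n : ℤ) ^ Nat.totient n := by
  rw [← Int.natAbs_dvd, IsCyclotomicExtension.Rat.natAbs_discr n L]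
  exact_mod_cast Nat.div_dvd_of_dvd
    (Nat.prod_primeFactors_pow_totient_ediv_dvd (NeZero.pos n))

/-- The discriminant of any subfield of the `n`-th cyclotomic field
divides `n ^ φ(n)`. -/
theorem discr_dvd_pow_totient_of_le_cycField (n : ℕ) (hn : 0 < n)
    (K : Subfield ℂ) [NumberField ↥K] (hK : K ≤ cycField n) :
    NumberField.discr ↥K ∣ (n : ℤ) ^ Nat.totient n := by
  have : NeZero n := ⟨hn.ne'⟩
  have hζ := Complex.isPrimitiveRoot_exp n hn.ne'
  let L := IntermediateField.adjoin ℚ {Complex.exp (2 * Real.pi * Complex.I / n)}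
  have : IsCyclotomicExtension {n} ℚ L :=
    (IntermediateField.isCyclotomicExtension_singleton_iff_eq_adjoin n ℚ ℂ L hζ).mpr rfl
  have : NumberField L := IsCyclotomicExtension.numberField {n} ℚ L
  let f : K →+* L := Subfield.inclusion (hK.trans hζ.cycField_le_adjoin)
  let _ : Algebra K L := f.toAlgebra
  exact (NumberField.discr_dvd_discr K L).trans
    (IsCyclotomicExtension.Rat.discr_dvd_pow_totient n L)
end

section
/- Let K and L be number fields (subfields of ℂ) that are Galois over ℚ, let M := K ∩ L, let m := min{[KL : K], [KL : L]}, and let d_K, d_L, d_M denote absolute discriminants. Then d_M^m divides gcd(d_K, d_L), and gcd(d_K,d_L)·ℤ_{KL} ⊆ (gcd(d_K,d_L)/d_M^m)·ℤ_{KL} ⊆ ℤ_K·ℤ_L, where ℤ_K·ℤ_L is the subring of KL generated by ℤ_K and ℤ_L. In particular, if d_K and d_L are coprime then ℤ_{KL} = ℤ_K·ℤ_L. -/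
open CategoryTheory Module Pointwise
open scoped MatrixGroups

/-- The subring `ℤ_K·ℤ_L` of `ℂ` generated by the rings of integers of `K` and `L`. -/
noncomputable def prodOfIntegers (K L : Subfield ℂ) : Subring ℂ :=
  Subring.closure ((ringOfIntIn K : Set ℂ) ∪ (ringOfIntIn L : Set ℂ))

/-- The relative degree `[L : K]` for subfields `K ≤ L` of `ℂ`, computed as
`[L : ℚ]/[K : ℚ]`. -/
noncomputable def relDeg (K L : Subfield ℂ) : ℕ :=
  finrank ℚ ↥L / finrank ℚ ↥K

open scoped nonZeroDivisors NumberField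

/-- A finite torsion-free extension `B` of a Dedekind domain `A` has a finite system `y` of
elements together with a dual system `w` in the trace dual of `B`. -/
theorem exists_sum_mul_trace_eq (A B F K : Type*) [CommRing A] [IsDedekindDomain A] [Field F]
    [Algebra A F] [IsFractionRing A F] [CommRing B] [Algebra A B] [Module.Finite A B]
    [IsTorsionFree A B] [Field K] [Algebra B K] [Algebra F K] [Algebra A K]
    [IsScalarTower A F K] [IsScalarTower A B K] [IsIntegralClosure B A K] [FiniteDimensional F K]
    [Algebra.IsSeparable F K] :
    ∃ (n : ℕ) (y : Fin n → B) (w : Fin n → K),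
      (∀ i, w i ∈ Submodule.traceDual A F (1 : Submodule B K)) ∧
      ∀ z : K, ∑ i, w i * algebraMap F K (Algebra.trace F K (algebraMap B K (y i) * z)) = z := by
  classical
  have : Module.FinitePresentation A B := Module.finitePresentation_of_finite A B
  have : Module.Projective A B := Module.Flat.projective_of_finitePresentation
  obtain ⟨n, f, s, -, -, hfs⟩ := Module.Finite.exists_comp_eq_id_of_projective A B
  let y : Fin n → B := fun i => f (Pi.single i 1)
  have hy (b : B) : ∑ i, s b i • y i = b := by
    conv_rhs => rw [← LinearMap.id_apply (R := A) b, ← hfs, LinearMap.comp_apply,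
      pi_eq_sum_univ' (s b), map_sum]
    refine Finset.sum_congr rfl fun i _ => ?_
    rw [map_smul]
  have : IsLocalization (Algebra.algebraMapSubmonoid B A⁰) K :=
    IsIntegralClosure.isLocalization_of_isSeparable A F K B
  have hnd := traceForm_nondegenerate F K
  have hex (i : Fin n) : ∃ w : K, ∀ b : B,
      Algebra.trace F K (w * algebraMap B K b) = algebraMap A F (s b i) := by
    let φ : B →ₗ[A] F := Algebra.linearMap A F ∘ₗ LinearMap.proj i ∘ₗ s
    let ψ : K →ₗ[A] F := IsLocalizedModule.lift A⁰ (IsScalarTower.toAlgHom A B K).toLinearMap φ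
      (IsLocalizedModule.map_units (Algebra.linearMap A F))
    let ψ' : K →ₗ[F] F := ψ.extendScalarsOfIsLocalization A⁰ F
    refine ⟨((Algebra.traceForm F K).toDual hnd).symm ψ', fun b => ?_⟩
    rw [← Algebra.traceForm_apply, ← LinearMap.BilinForm.toDual_def hnd,
      LinearEquiv.apply_symm_apply]
    exact IsLocalizedModule.lift_apply A⁰ (IsScalarTower.toAlgHom A B K).toLinearMap φ
      (IsLocalizedModule.map_units (Algebra.linearMap A F)) b
  choose w hw using hex
  refine ⟨n, y, w, fun i => ?_, fun z => ?_⟩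
  · rw [Submodule.mem_traceDual]
    rintro _ ⟨b, rfl⟩
    refine ⟨s b i, ?_⟩
    rw [← hw, Algebra.traceForm_apply]
    simp [Algebra.smul_def]
  · have key (b : B) : Algebra.trace F K
        ((∑ i, w i * algebraMap F K (Algebra.trace F K (algebraMap B K (y i) * z))) *
          algebraMap B K b) = Algebra.trace F K (z * algebraMap B K b) := by
      conv_rhs => rw [← hy b]
      simp_rw [map_sum, Finset.sum_mul, Finset.mul_sum, map_sum]
      refine Finset.sum_congr rfl fun i _ => ?_
      have h₁ : algebraMap B K (s b i • y i) = algebraMap F K (algebraMap A F (s b i)) *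
          algebraMap B K (y i) := by
        rw [Algebra.smul_def, map_mul, ← IsScalarTower.algebraMap_apply A B K,
          ← IsScalarTower.algebraMap_apply A F K]
      rw [mul_right_comm, mul_comm, ← Algebra.smul_def (R := F), map_smul, hw, h₁, mul_left_comm,
        ← Algebra.smul_def (R := F), map_smul, smul_eq_mul, smul_eq_mul, mul_comm, mul_comm z]
    refine sub_eq_zero.mp (hnd.1 _ fun u => ?_)
    obtain ⟨⟨b, _, a, ha, rfl⟩, hba⟩ :=
      IsLocalization.surj (Algebra.algebraMapSubmonoid B A⁰) u
    have ha' : algebraMap A F a ≠ 0 := IsFractionRing.to_map_ne_zero_of_mem_nonZeroDivisors ha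
    refine (mul_eq_zero.mp ?_).resolve_left ha'
    rw [← smul_eq_mul, ← map_smul, Algebra.traceForm_apply, Algebra.smul_def, mul_comm _ u,
      ← IsScalarTower.algebraMap_apply A F K, IsScalarTower.algebraMap_apply A B K, hba,
      sub_mul, map_sub, key, sub_self]

theorem absNorm_differentIdeal_mul_mem_closure {F E : Type*} [Field F] [Field E] [NumberField F]
    [NumberField E] [Algebra F E] (L K : IntermediateField F E) (h₁ : L.LinearDisjoint K)
    (h₂ : L ⊔ K = ⊤) {x : E} (hx : IsIntegral ℤ x) :
    (Ideal.absNorm (differentIdeal (𝓞 F) (𝓞 K)) : E) * x ∈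
      Subring.closure {z : E | IsIntegral ℤ z ∧ (z ∈ L ∨ z ∈ K)} := by
  obtain ⟨n, y, w, hw, hz⟩ := exists_sum_mul_trace_eq (𝓞 F) (𝓞 K) F K
  have h₂' : L.toSubalgebra ⊔ K.toSubalgebra = ⊤ := by
    simpa [IntermediateField.sup_toSubalgebra_of_isAlgebraic_right] using
      congr_arg IntermediateField.toSubalgebra h₂
  let B₁ := h₁.basisOfBasisRight h₂' (Module.finBasis F K)
  let T : E →ₗ[L] E := ∑ i, (w i : E) • (Algebra.linearMap L E ∘ₗ Algebra.trace L E ∘ₗ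
    LinearMap.mulLeft L ((y i : K) : E))
  have hT : T = LinearMap.id := by
    refine B₁.ext fun j => ?_
    rw [LinearMap.id_apply, IntermediateField.LinearDisjoint.basisOfBasisRight_apply]
    conv_rhs => rw [← hz (Module.finBasis F K j), map_sum]
    rw [LinearMap.sum_apply]
    refine Finset.sum_congr rfl fun i _ => ?_
    have := h₁.trace_algebraMap h₂ (algebraMap (𝓞 K) K (y i) * Module.finBasis F K j)
    simp only [LinearMap.smul_apply, LinearMap.comp_apply, LinearMap.mulLeft_apply,
      Algebra.linearMap_apply, smul_eq_mul, map_mul] at this ⊢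
    exact congr_arg (fun t : L => (w i : E) * (t : E)) this
  have hx' : T x = x := by rw [hT, LinearMap.id_apply]
  rw [← hx', LinearMap.sum_apply, Finset.mul_sum]
  refine sum_mem fun i _ => ?_
  simp only [LinearMap.smul_apply, LinearMap.comp_apply, LinearMap.mulLeft_apply,
      Algebra.linearMap_apply, smul_eq_mul]
  rw [← mul_assoc]
  refine mul_mem (Subring.subset_closure ⟨?_, Or.inr ?_⟩)
    (Subring.subset_closure ⟨?_, Or.inl (SetLike.coe_mem _)⟩)
  · have hn : algebraMap (𝓞 K) K (Ideal.absNorm (differentIdeal (𝓞 F) (𝓞 K))) * w i ∈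
        (1 : FractionalIdeal (𝓞 K)⁰ K) := by
      have hD : (FractionalIdeal.dual (𝓞 F) F (1 : FractionalIdeal (𝓞 K)⁰ K)) ≠ 0 :=
        FractionalIdeal.dual_ne_zero _ _ one_ne_zero
      rw [← inv_mul_cancel₀ hD, ← coeIdeal_differentIdeal (𝓞 F) F K (𝓞 K)]
      refine FractionalIdeal.mul_mem_mul (FractionalIdeal.mem_coeIdeal_of_mem _
        (Ideal.absNorm_mem _)) ?_
      rw [← FractionalIdeal.mem_coe, FractionalIdeal.coe_dual_one]
      exact hw i
    obtain ⟨v, hv⟩ := (FractionalIdeal.mem_one_iff _).mp hn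
    convert (v.2.map (IsScalarTower.toAlgHom ℤ K E)) using 1
    refine (congr_arg (algebraMap K E) hv.symm).symm ▸ ?_
    simp
  · exact mul_mem (natCast_mem _ _) (w i).2
  · have hyx : IsIntegral ℤ (((y i : K) : E) * x) :=
      IsIntegral.mul ((y i).2.map (IsScalarTower.toAlgHom ℤ K E)) hx
    exact (Algebra.isIntegral_trace hyx).map (IsScalarTower.toAlgHom ℤ L E)

theorem natAbs_discr_eq_absNorm_mul_pow {F E : Type*} [Field F] [Field E] [NumberField F]
    [NumberField E] [Algebra F E] :
    (NumberField.discr E).natAbs = Ideal.absNorm (differentIdeal (𝓞 F) (𝓞 E)) *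
      (NumberField.discr F).natAbs ^ finrank F E :=
  NumberField.natAbs_discr_eq_absNorm_differentIdeal_mul_natAbs_discr_pow F (𝓞 F) E (𝓞 E)

theorem gcd_dvd_of_gcd_mul_pow_eq {a b c i j n q : ℕ} (hc : c ≠ 0) (hi : n ≤ i) (hj : n ≤ j)
    (h : Nat.gcd (a * c ^ i) (b * c ^ j) = c ^ n * q) : Nat.gcd a b ∣ q := by
  refine Nat.dvd_of_mul_dvd_mul_left (pow_pos (Nat.pos_of_ne_zero hc) n) (h ▸ Nat.dvd_gcd ?_ ?_)
  · rw [mul_comm a]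
    exact mul_dvd_mul (pow_dvd_pow c hi) (Nat.gcd_dvd_left a b)
  · rw [mul_comm b]
    exact mul_dvd_mul (pow_dvd_pow c hj) (Nat.gcd_dvd_right a b)

section LinearDisjoint

variable {F E : Type*} [Field F] [Field E] [NumberField F] [NumberField E] [Algebra F E]
  (L K : IntermediateField F E)

theorem discr_pow_min_finrank_dvd_gcd :
    (NumberField.discr F) ^ min (finrank F K) (finrank F L) ∣
      (Int.gcd (NumberField.discr K) (NumberField.discr L) : ℤ) := by
  rw [← Int.natAbs_dvd_natAbs, Int.natAbs_pow, Int.natAbs_natCast, Int.gcd]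
  refine Nat.dvd_gcd ?_ ?_
  · rw [natAbs_discr_eq_absNorm_mul_pow (F := F) (E := K)]
    exact (pow_dvd_pow _ (min_le_left _ _)).mul_left _
  · rw [natAbs_discr_eq_absNorm_mul_pow (F := F) (E := L)]
    exact (pow_dvd_pow _ (min_le_right _ _)).mul_left _

variable {L K} in
theorem mul_mem_closure_of_gcd_discr_eq (h₁ : L.LinearDisjoint K) (h₂ : L ⊔ K = ⊤) {q : ℤ}
    (hq : (Int.gcd (NumberField.discr K) (NumberField.discr L) : ℤ) =
      (NumberField.discr F) ^ min (finrank F K) (finrank F L) * q) {x : E} (hx : IsIntegral ℤ x) :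
    (q : E) * x ∈ Subring.closure {z : E | IsIntegral ℤ z ∧ (z ∈ L ∨ z ∈ K)} := by
  have hK := absNorm_differentIdeal_mul_mem_closure L K h₁ h₂ hx
  have hL := absNorm_differentIdeal_mul_mem_closure K L h₁.symm (by rwa [sup_comm]) hx
  simp_rw [or_comm (a := _ ∈ K)] at hL
  set a := Ideal.absNorm (differentIdeal (𝓞 F) (𝓞 K))
  set b := Ideal.absNorm (differentIdeal (𝓞 F) (𝓞 L))
  have hab : (Nat.gcd a b : ℤ) ∣ q := by
    rw [← Int.dvd_natAbs, Int.natCast_dvd_natCast]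
    apply_fun Int.natAbs at hq
    rw [Int.natAbs_mul, Int.natAbs_pow, Int.natAbs_natCast, Int.gcd,
      natAbs_discr_eq_absNorm_mul_pow (F := F) (E := K),
      natAbs_discr_eq_absNorm_mul_pow (F := F) (E := L)] at hq
    exact gcd_dvd_of_gcd_mul_pow_eq (Int.natAbs_ne_zero.mpr (NumberField.discr_ne_zero F))
      (min_le_left _ _) (min_le_right _ _) hq
  obtain ⟨r, rfl⟩ := hab
  have hg : ((Nat.gcd a b : ℤ) : E) = a * (Nat.gcdA a b : ℤ) + b * (Nat.gcdB a b : ℤ) := by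
    rw [Nat.gcd_eq_gcd_ab]
    push_cast
    ring
  have : (((Nat.gcd a b : ℤ) * r : ℤ) : E) * x =
      ((Nat.gcdA a b * r : ℤ) : E) * (a * x) + ((Nat.gcdB a b * r : ℤ) : E) * (b * x) := by
    rw [Int.cast_mul, hg]
    push_cast
    ring
  rw [this]
  exact add_mem (mul_mem (intCast_mem _ _) hK) (mul_mem (intCast_mem _ _) hL)

end LinearDisjoint

/-- The elements of `E` lying in `K`, as an intermediate field of `E / F`, where `F`, `K` and `E`
are subfields of a common field with `F ≤ K`. -/
def Subfield.toIntermediateFieldOfLE {Ω : Type*} [Field Ω] {F E : Subfield Ω} [Algebra F E]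
    (hFE : ∀ x : F, (algebraMap F E x : Ω) = x) (K : Subfield Ω) (hFK : F ≤ K) :
    IntermediateField F E :=
  (K.comap E.subtype).toIntermediateField fun x => by
    simpa [hFE] using hFK x.2

/-- `toIntermediateFieldOfLE` does not change the underlying field. -/
def Subfield.toIntermediateFieldOfLEEquiv {Ω : Type*} [Field Ω] {F E : Subfield Ω} [Algebra F E]
    (hFE : ∀ x : F, (algebraMap F E x : Ω) = x) (K : Subfield Ω) (hFK : F ≤ K) (hKE : K ≤ E) :
    K ≃+* toIntermediateFieldOfLE hFE K hFK where
  toFun x := ⟨⟨x, hKE x.2⟩, x.2⟩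
  invFun x := ⟨x.1.1, x.2⟩
  left_inv _ := rfl
  right_inv _ := rfl
  map_mul' _ _ := rfl
  map_add' _ _ := rfl

theorem prodOfIntegers_le (K L : Subfield ℂ) : prodOfIntegers K L ≤ ringOfIntIn (K ⊔ L) := by
  refine Subring.closure_le.mpr (Set.union_subset ?_ ?_)
  · exact fun x hx => ⟨hx.1, (le_sup_left : K ≤ K ⊔ L) hx.2⟩
  · exact fun x hx => ⟨hx.1, (le_sup_right : L ≤ K ⊔ L) hx.2⟩

theorem discr_inf_pow_dvd_gcd_and_mul_mem_prodOfIntegers (K L : Subfield ℂ)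
    [NumberField ↥K] [NumberField ↥L] [NumberField ↥(K ⊔ L)] [NumberField ↥(K ⊓ L)]
    [IsGalois ℚ ↥K] :
    (NumberField.discr ↥(K ⊓ L)) ^ (min (relDeg K (K ⊔ L)) (relDeg L (K ⊔ L))) ∣
      (Int.gcd (NumberField.discr K) (NumberField.discr L) : ℤ) ∧
    ∀ q : ℤ, (Int.gcd (NumberField.discr K) (NumberField.discr L) : ℤ) =
      (NumberField.discr ↥(K ⊓ L)) ^ (min (relDeg K (K ⊔ L)) (relDeg L (K ⊔ L))) * q →
      ∀ x ∈ ringOfIntIn (K ⊔ L), (q : ℂ) * x ∈ prodOfIntegers K L := by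
  have hle : K ⊓ L ≤ K ⊔ L := inf_le_left.trans le_sup_left
  let _ : Algebra ↥(K ⊓ L) ↥(K ⊔ L) := (Subfield.inclusion hle).toAlgebra
  have hFE (x : ↥(K ⊓ L)) : (algebraMap ↥(K ⊓ L) ↥(K ⊔ L) x : ℂ) = x := rfl
  let K₁ := Subfield.toIntermediateFieldOfLE hFE K inf_le_left
  let L₁ := Subfield.toIntermediateFieldOfLE hFE L inf_le_right
  let eK : K ≃+* K₁ := Subfield.toIntermediateFieldOfLEEquiv hFE K inf_le_left le_sup_left
  let eL : L ≃+* L₁ := Subfield.toIntermediateFieldOfLEEquiv hFE L inf_le_right le_sup_right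
  let eK' : K ≃ₐ[ℚ] K₁ := AlgEquiv.ofRingEquiv (f := eK) fun _ ↦ by simp
  let eL' : L ≃ₐ[ℚ] L₁ := AlgEquiv.ofRingEquiv (f := eL) fun _ ↦ by simp
  have : IsGalois ℚ K₁ := IsGalois.of_algEquiv eK'
  have : IsGalois ↥(K ⊓ L) K₁ := IsGalois.tower_top_of_isGalois ℚ ↥(K ⊓ L) K₁
  have hinf : K₁ ⊓ L₁ = ⊥ :=
    eq_bot_iff.mpr fun x hx => IntermediateField.mem_bot.mpr ⟨⟨x, hx.1, hx.2⟩, rfl⟩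
  have hdisj : K₁.LinearDisjoint L₁ := .of_inf_eq_bot hinf
  have hsup : K₁ ⊔ L₁ = ⊤ := by
    refine eq_top_iff.mpr fun x _ => ?_
    have : K ⊔ L ≤ (K₁ ⊔ L₁).toSubfield.map (K ⊔ L).subtype :=
      sup_le
        (fun y hy => ⟨⟨y, (le_sup_left : K ≤ K ⊔ L) hy⟩,
          (le_sup_left : K₁ ≤ K₁ ⊔ L₁) hy, rfl⟩)
        (fun y hy => ⟨⟨y, (le_sup_right : L ≤ K ⊔ L) hy⟩,
          (le_sup_right : L₁ ≤ K₁ ⊔ L₁) hy, rfl⟩)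
    obtain ⟨y, hy, hyx⟩ := this x.2
    rwa [← Subtype.ext hyx]
  have hrK : relDeg K (K ⊔ L) = finrank ↥(K ⊓ L) L₁ := by
    rw [← hdisj.finrank_left_eq_finrank hsup, relDeg, eK'.toLinearEquiv.finrank_eq,
      ← finrank_mul_finrank ℚ K₁ ↥(K ⊔ L), Nat.mul_div_cancel_left _ finrank_pos]
  have hrL : relDeg L (K ⊔ L) = finrank ↥(K ⊓ L) K₁ := by
    rw [← hdisj.finrank_right_eq_finrank hsup, relDeg, eL'.toLinearEquiv.finrank_eq,
      ← finrank_mul_finrank ℚ L₁ ↥(K ⊔ L), Nat.mul_div_cancel_left _ finrank_pos]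
  rw [hrK, hrL, NumberField.discr_eq_discr_of_ringEquiv K eK,
    NumberField.discr_eq_discr_of_ringEquiv L eL, Int.gcd_comm]
  refine ⟨discr_pow_min_finrank_dvd_gcd K₁ L₁, fun q hq x hx => ?_⟩
  have hx' : IsIntegral ℤ (⟨x, hx.2⟩ : ↥(K ⊔ L)) :=
    (isIntegral_algHom_iff (IsScalarTower.toAlgHom ℤ ↥(K ⊔ L) ℂ) Subtype.val_injective).mp hx.1
  have hmem := mul_mem_closure_of_gcd_discr_eq hdisj hsup hq hx'
  have hcl : Subring.closure {z : ↥(K ⊔ L) | IsIntegral ℤ z ∧ (z ∈ K₁ ∨ z ∈ L₁)} ≤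
      (prodOfIntegers K L).comap (K ⊔ L).subtype := by
    refine Subring.closure_le.mpr fun z hz => Subring.subset_closure ?_
    have hzi : IsIntegral ℤ (z : ℂ) := hz.1.map (IsScalarTower.toAlgHom ℤ ↥(K ⊔ L) ℂ)
    exact hz.2.imp (fun h => ⟨hzi, h⟩) (fun h => ⟨hzi, h⟩)
  simpa using hcl hmem

/-- For Galois number fields `K, L` with `M := K ∩ L` and
`m := min([KL:K], [KL:L])`: `d_M^m ∣ gcd(d_K, d_L)`, and
`gcd(d_K,d_L)·ℤ_{KL} ⊆ (gcd(d_K,d_L)/d_M^m)·ℤ_{KL} ⊆ ℤ_K·ℤ_L`; in particular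
`ℤ_{KL} = ℤ_K·ℤ_L` if the discriminants are coprime. -/
theorem gcd_discr_smul_subset_prodOfIntegers (K L : Subfield ℂ)
    [NumberField ↥K] [NumberField ↥L] [NumberField ↥(K ⊔ L)] [NumberField ↥(K ⊓ L)]
    [IsGalois ℚ ↥K] [IsGalois ℚ ↥L]
    (dK dL dM : ℤ) (hdK : dK = NumberField.discr ↥K) (hdL : dL = NumberField.discr ↥L)
    (hdM : dM = NumberField.discr ↥(K ⊓ L))
    (m : ℕ) (hm : m = min (relDeg K (K ⊔ L)) (relDeg L (K ⊔ L)))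
    (g : ℤ) (hg : g = Int.gcd dK dL) :
    dM ^ m ∣ g ∧
      (g : ℂ) • (ringOfIntIn (K ⊔ L) : Set ℂ) ⊆
        ((g / dM ^ m : ℤ) : ℂ) • (ringOfIntIn (K ⊔ L) : Set ℂ) ∧
      ((g / dM ^ m : ℤ) : ℂ) • (ringOfIntIn (K ⊔ L) : Set ℂ) ⊆
        (prodOfIntegers K L : Set ℂ) ∧
      (IsCoprime dK dL → ringOfIntIn (K ⊔ L) = prodOfIntegers K L) := by
  obtain ⟨⟨q, hq⟩, hmul⟩ := discr_inf_pow_dvd_gcd_and_mul_mem_prodOfIntegers K L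
  rw [← hdK, ← hdL, ← hdM, ← hm, ← hg] at hq hmul
  have hd : dM ^ m ≠ 0 := pow_ne_zero _ (hdM ▸ NumberField.discr_ne_zero _)
  have hdiv : g / dM ^ m = q := by rw [hq, Int.mul_ediv_cancel_left _ hd]
  rw [hdiv]
  refine ⟨⟨q, hq⟩, ?_, ?_, fun hc => le_antisymm (fun x hx => ?_) (prodOfIntegers_le K L)⟩
  · rintro _ ⟨x, hx, rfl⟩
    refine ⟨((dM ^ m : ℤ) : ℂ) * x, mul_mem (intCast_mem _ _) hx, ?_⟩
    simp only [smul_eq_mul, hq]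
    push_cast
    ring
  · rintro _ ⟨x, hx, rfl⟩
    exact hmul q hq x hx
  · have hg1 : dM ^ m * q = 1 := by
      rw [← hq, hg, Int.isCoprime_iff_gcd_eq_one.mp hc, Nat.cast_one]
    have := mul_mem (intCast_mem (prodOfIntegers K L) (dM ^ m)) (hmul q hq x hx)
    rwa [← mul_assoc, ← Int.cast_mul, hg1, Int.cast_one, one_mul] at this
end
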